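/- Parametric Steinitz selection: let f_t : [a,b] → ℝⁿ (n ≥ 3) be a continuous family of injective continuous curves, and x : [0,1] → ℝⁿ a continuous map with x(t) in the interior of the convex hull of the image of f_t for all t. Then there exist continuous functions s₁, …, s_{4n} : [0,1] → [a,b], pairwise distinct at each t, such that x(t) lies in the interior of the convex hull of {f_t(s₁(t)), …, f_t(s_{4n}(t))} for all t. -/

import Mathlib

open Set Metric Filter Topology Module
open scoped RealInnerProductSpace Pointwise

section Steinitz

/-- Conic Carathéodory theorem, in dimension-count form: a nonnegative combination of finitely many
vectors can be rewritten as one of at most `finrank ℝ V` of them. -/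
theorem exists_nonneg_combination_card_le_finrank {V : Type*} [AddCommGroup V] [Module ℝ V]
    [FiniteDimensional ℝ V] (s : Finset V) (w : V → ℝ) (hw : ∀ v ∈ s, 0 ≤ w v) :
    ∃ t ⊆ s, t.card ≤ finrank ℝ V ∧ ∃ w' : V → ℝ, (∀ v ∈ t, 0 ≤ w' v) ∧
      ∑ v ∈ t, w' v • v = ∑ v ∈ s, w v • v := by
  classical
  induction s using Finset.strongInduction generalizing w with
  | H s ih =>
    by_cases hs : s.card ≤ finrank ℝ V
    · exact ⟨s, subset_rfl, hs, w, hw, rfl⟩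
    obtain ⟨g, hg, hpos⟩ : ∃ g : V → ℝ, ∑ v ∈ s, g v • v = 0 ∧ ∃ v ∈ s, 0 < g v := by
      obtain ⟨g, hg, v, hv, hgv⟩ := exists_nontrivial_relation_of_finrank_lt_card (not_le.1 hs)
      rcases lt_or_gt_of_ne hgv with h | h
      · exact ⟨-g, by simp [hg], v, hv, by simpa using h⟩
      · exact ⟨g, hg, v, hv, h⟩
    obtain ⟨v₀, hv₀, hmin⟩ := (s.filter fun v => 0 < g v).exists_min_image (fun v => w v / g v)
      (by obtain ⟨v, hv, hgv⟩ := hpos; exact ⟨v, by simp [hv, hgv]⟩)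
    rw [Finset.mem_filter] at hv₀
    obtain ⟨t, hts, ht, w', hw', hsum⟩ := ih (s.erase v₀) (Finset.erase_ssubset hv₀.1)
      (fun v => w v - w v₀ / g v₀ * g v) (by
        intro v hv
        have hvs := Finset.mem_of_mem_erase hv
        rcases lt_or_ge 0 (g v) with h | h
        · have := hmin v (by simp [hvs, h])
          rw [le_div_iff₀ h] at this
          linarith
        · have := mul_nonpos_of_nonneg_of_nonpos (div_nonneg (hw _ hv₀.1) hv₀.2.le) h
          linarith [hw v hvs])
    refine ⟨t, hts.trans (Finset.erase_subset _ _), ht, w', hw', hsum.trans ?_⟩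
    rw [Finset.sum_erase _ (by simp [hv₀.2.ne'])]
    simp only [sub_smul, Finset.sum_sub_distrib, mul_smul, ← Finset.smul_sum, hg, smul_zero,
      sub_zero]

variable {E : Type*} [NormedAddCommGroup E] [InnerProductSpace ℝ E]

/-- The family `p` meets every open half-space bounded by a hyperplane through the origin. -/
def MeetsOpenHalfSpaces {ι : Type*} (p : ι → E) : Prop :=
  ∀ u ∈ sphere (0 : E) 1, ∃ i, 0 < ⟪u, p i⟫

theorem MeetsOpenHalfSpaces.of_range_subset {ι κ : Type*} {p : ι → E} {q : κ → E}
    (hp : MeetsOpenHalfSpaces p) (h : range p ⊆ range q) : MeetsOpenHalfSpaces q := by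
  intro u hu
  obtain ⟨i, hi⟩ := hp u hu
  obtain ⟨j, hj⟩ := h (mem_range_self i)
  exact ⟨j, hj ▸ hi⟩

variable [FiniteDimensional ℝ E]

theorem isOpen_setOf_meetsOpenHalfSpaces {ι Y : Type*} [TopologicalSpace Y] {p : Y → ι → E}
    (hp : ∀ i, Continuous fun y => p y i) : IsOpen {y | MeetsOpenHalfSpaces (p y)} := by
  refine isOpen_iff_mem_nhds.2 fun y hy =>
    (isCompact_sphere _ _).eventually_forall_of_forall_eventually fun u hu => ?_
  obtain ⟨i, hi⟩ := hy u hu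
  have hc : Continuous fun q : Y × E => ⟪q.2, p q.1 i⟫ :=
    continuous_snd.inner ((hp i).comp continuous_fst)
  exact ((hc.tendsto (y, u)).eventually_const_lt hi).mono fun q hq => ⟨i, hq⟩

/-- **Steinitz's theorem**: if `0` is interior to the convex hull of `X`, then at most `2 dim E`
points of `X` already meet every open half-space bounded by a hyperplane through `0`. -/
theorem exists_finset_card_le_forall_exists_inner_pos {X : Set E}
    (hX : (0 : E) ∈ interior (convexHull ℝ X)) :
    ∃ T : Finset E, ↑T ⊆ X ∧ T.card ≤ 2 * finrank ℝ E ∧ ∀ u : E, u ≠ 0 → ∃ p ∈ T, 0 < ⟪u, p⟫ := by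
  classical
  have hspan : ⊤ ≤ Submodule.span ℝ X := top_le_iff.2 <|
    Submodule.eq_top_of_nonempty_interior' _
      ⟨0, interior_mono (convexHull_min Submodule.subset_span (Submodule.convex _)) hX⟩
  let b := (Basis.ofSpan hspan).reindex
    (Fintype.equivFinOfCardEq (finrank_eq_card_basis (Basis.ofSpan hspan)).symm)
  have hbX : range b ⊆ X := by
    rw [Basis.range_reindex]
    exact Basis.ofSpan_subset hspan
  obtain ⟨ε, hε, hmem⟩ : ∃ ε > (0 : ℝ), -(ε • ∑ i, b i) ∈ convexHull ℝ X := by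
    have hlim : Tendsto (fun ε : ℝ => -(ε • ∑ i, b i)) (𝓝[>] 0) (𝓝 0) :=
      tendsto_nhdsWithin_of_tendsto_nhds <| by
        have : Continuous fun ε : ℝ => -(ε • ∑ i, b i) := by fun_prop
        simpa using this.tendsto 0
    obtain ⟨ε, hε, hε'⟩ :=
      ((hlim.eventually (mem_interior_iff_mem_nhds.1 hX)).and self_mem_nhdsWithin).exists
    exact ⟨ε, hε', hε⟩
  rw [convexHull_eq_union_convexHull_finite_subsets] at hmem
  simp only [mem_iUnion, exists_prop] at hmem
  obtain ⟨s, hsX, hmem⟩ := hmem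
  obtain ⟨w, hw, -, hsum⟩ := Finset.mem_convexHull'.1 hmem
  obtain ⟨t, hts, htcard, w', hw', hsum'⟩ := exists_nonneg_combination_card_le_finrank s w hw
  refine ⟨Finset.univ.image b ∪ t, ?_, ?_, fun u hu => ?_⟩
  · rw [Finset.coe_union, union_subset_iff]
    exact ⟨by simpa using hbX, (Finset.coe_subset.2 hts).trans hsX⟩
  · have := Finset.card_union_le (Finset.univ.image b) t
    have := Finset.card_image_le (s := Finset.univ) (f := b)
    simp only [Finset.card_univ, Fintype.card_fin] at this
    omega
  · by_contra! hneg
    have hb : ∀ i, ⟪u, b i⟫ ≤ 0 := fun i => hneg _ (by simp)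
    have ht : ⟪u, ∑ v ∈ t, w' v • v⟫ ≤ 0 := by
      rw [inner_sum]
      refine Finset.sum_nonpos fun v hv => ?_
      rw [inner_smul_right]
      exact mul_nonpos_of_nonneg_of_nonpos (hw' v hv) (hneg v (Finset.mem_union_right _ hv))
    rw [hsum', hsum, inner_neg_right, inner_smul_right, inner_sum] at ht
    have hzero : ∑ i, ⟪u, b i⟫ = 0 :=
      le_antisymm (Finset.sum_nonpos fun i _ => hb i) (by nlinarith)
    rw [Finset.sum_eq_zero_iff_of_nonpos fun i _ => hb i] at hzero
    exact hu (InnerProductSpace.ext_inner_right_basis b fun i => by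
      simpa using hzero i (Finset.mem_univ i))

theorem exists_fin_meetsOpenHalfSpaces {X : Set E} (hX : (0 : E) ∈ interior (convexHull ℝ X)) :
    ∃ p : Fin (2 * finrank ℝ E) → E, range p ⊆ X ∧ MeetsOpenHalfSpaces p := by
  obtain ⟨x₀, hx₀⟩ : X.Nonempty := convexHull_nonempty_iff.1 ⟨0, interior_subset hX⟩
  obtain ⟨T, hTX, hcard, hT⟩ := exists_finset_card_le_forall_exists_inner_pos hX
  obtain ⟨e⟩ : Nonempty (T ↪ Fin (2 * finrank ℝ E)) :=
    Function.Embedding.nonempty_of_card_le (by simpa using hcard)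
  refine ⟨Function.extend e Subtype.val fun _ => x₀, ?_, fun u hu => ?_⟩
  · refine (range_extend_subset _ _ _).trans (union_subset ?_ ?_)
    · rintro _ ⟨v, rfl⟩
      exact hTX v.2
    · rintro _ ⟨i, -, rfl⟩
      exact hx₀
  · obtain ⟨v, hv, hpos⟩ := hT u (ne_zero_of_mem_unit_sphere ⟨u, hu⟩)
    exact ⟨e ⟨v, hv⟩, by rwa [e.injective.extend_apply]⟩

/-- If a nonempty finite family meets every open half-space bounded by a hyperplane through `y`, then
`y` is interior to its convex hull. -/
theorem MeetsOpenHalfSpaces.mem_interior_convexHull_range {ι : Type*} [Finite ι] [Nonempty ι]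
    {p : ι → E} {y : E} (h : MeetsOpenHalfSpaces fun i => p i - y) :
    y ∈ interior (convexHull ℝ (range p)) := by
  have hnear : ∀ᶠ z in 𝓝 y, MeetsOpenHalfSpaces fun i => p i - z :=
    (isOpen_setOf_meetsOpenHalfSpaces fun i => by fun_prop).mem_nhds h
  refine mem_interior_iff_mem_nhds.2 (hnear.mono fun z hz => ?_)
  by_contra hzC
  obtain ⟨g, c, hg, hc⟩ := geometric_hahn_banach_closed_point (convex_convexHull ℝ (range p))
    ((finite_range p).isClosed_convexHull ℝ) hzC
  set u := (InnerProductSpace.toDual ℝ E).symm g with hu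
  have hgu : ∀ v, ⟪u, v⟫ = g v := fun v => InnerProductSpace.toDual_symm_apply
  have hneg : ∀ i, ⟪u, p i - z⟫ < 0 := fun i => by
    rw [hgu, map_sub]
    linarith [hg _ (subset_convexHull ℝ _ (mem_range_self i))]
  have hu0 : u ≠ 0 := by
    rintro hu0
    obtain ⟨i⟩ := ‹Nonempty ι›
    simpa [hu0] using hneg i
  obtain ⟨i, hi⟩ := hz (‖u‖⁻¹ • u) (by simp [norm_smul, hu0])
  rw [real_inner_smul_left] at hi
  exact (hneg i).not_gt (pos_of_mul_pos_right hi (by positivity))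

end Steinitz

section Selection

theorem Tuple.lipschitzWith_comp_sort (m : ℕ) :
    LipschitzWith 1 fun c : Fin m → ℝ => c ∘ Tuple.sort c := by
  have hiff : ∀ (c : Fin m → ℝ) (k : Fin m) (r : ℝ),
      (k : ℕ) < (Finset.univ.filter fun i => c i ≤ r).card ↔ (c ∘ Tuple.sort c) k ≤ r := by
    intro c k r
    rw [← Tuple.lt_card_le_iff_apply_le_of_monotone (Tuple.monotone_sort c)]
    have : (Finset.univ.filter fun i => (c ∘ Tuple.sort c) i ≤ r).card =
        (Finset.univ.filter fun i => c i ≤ r).card :=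
      Finset.card_equiv (Tuple.sort c) (by simp)
    rw [this]
  have hle : ∀ (c c' : Fin m → ℝ) (k : Fin m),
      (c ∘ Tuple.sort c) k ≤ (c' ∘ Tuple.sort c') k + dist c c' := by
    intro c c' k
    refine (hiff _ _ _).1 (((hiff c' k _).2 le_rfl).trans_le (Finset.card_le_card ?_))
    intro i hi
    simp only [Finset.mem_filter, Finset.mem_univ, true_and] at hi ⊢
    have := (le_abs_self _).trans (dist_le_pi_dist c c' i)
    linarith
  refine LipschitzWith.of_dist_le_mul fun c c' => ?_
  rw [NNReal.coe_one, one_mul, dist_pi_le_iff dist_nonneg]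
  intro k
  have h₁ := hle c c' k
  have h₂ := hle c' c k
  rw [dist_comm c' c] at h₂
  rw [Real.dist_eq, abs_le]
  constructor <;> linarith

variable {E : Type*} [NormedAddCommGroup E] [InnerProductSpace ℝ E] [FiniteDimensional ℝ E]
  {F : ℝ → ℝ → E}

/-- Pointwise selections can be glued to a continuous one at the price of doubling the number of
points: on each interval of a fine subdivision one half of the points stays at a good
configuration while the other half moves to the next one. -/
theorem exists_continuous_sum_selection (hF : Continuous fun q : ℝ × ℝ => F q.1 q.2)
    {ι : Type*} {C : Set ℝ} (hC : Convex ℝ C)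
    (h : ∀ t ∈ Icc (0 : ℝ) 1, ∃ A : ι → ℝ, (∀ i, A i ∈ C) ∧
      MeetsOpenHalfSpaces fun i => F t (A i)) :
    ∃ c : ι ⊕ ι → ℝ → ℝ, (∀ i, Continuous (c i)) ∧ (∀ i t, c i t ∈ C) ∧
      ∀ t ∈ Icc (0 : ℝ) 1, MeetsOpenHalfSpaces fun i => F t (c i t) := by
  obtain ⟨δ, hδ, hball⟩ := lebesgue_number_lemma_of_metric (isCompact_Icc (a := (0 : ℝ)) (b := 1))
    (c := fun A : {A : ι → ℝ // ∀ i, A i ∈ C} => {t | MeetsOpenHalfSpaces fun i => F t (A.1 i)})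
    (fun A => isOpen_setOf_meetsOpenHalfSpaces fun i =>
      hF.comp (continuous_id.prodMk continuous_const))
    (fun t ht => by
      obtain ⟨A, hA, hA'⟩ := h t ht
      exact mem_iUnion.2 ⟨⟨A, hA⟩, hA'⟩)
  obtain ⟨N, hN⟩ := exists_nat_one_div_lt hδ
  have hN0 : (0 : ℝ) < N + 1 := by positivity
  have hstep : ∀ m : ℕ, m ≤ N + 1 → ∃ A : ι → ℝ, (∀ i, A i ∈ C) ∧ ∀ τ : ℝ,
      m ≤ (N + 1) * τ → (N + 1) * τ ≤ m + 1 → MeetsOpenHalfSpaces fun i => F τ (A i) := by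
    intro m hm
    have hm' : (m : ℝ) ≤ N + 1 := mod_cast hm
    obtain ⟨A, hA⟩ := hball (m / (N + 1)) ⟨by positivity, (div_le_one hN0).2 hm'⟩
    refine ⟨A.1, A.2, fun τ h₁ h₂ => hA ?_⟩
    have hτ : τ - m / (N + 1) = ((N + 1) * τ - m) / (N + 1) := by field_simp
    rw [mem_ball, Real.dist_eq, hτ, abs_of_nonneg (div_nonneg (by linarith) hN0.le)]
    exact (div_le_div_of_nonneg_right (by linarith) hN0.le).trans_lt hN
  have key : ∀ m : ℕ, m ≤ N + 1 → ∃ (c₁ c₂ : ι → ℝ → ℝ) (A : ι → ℝ),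
      (∀ i, Continuous (c₁ i)) ∧ (∀ i, Continuous (c₂ i)) ∧
      (∀ i t, c₁ i t ∈ C) ∧ (∀ i t, c₂ i t ∈ C) ∧
      (∀ τ : ℝ, m ≤ (N + 1) * τ → ∀ i, c₂ i τ = A i) ∧
      (∀ τ : ℝ, m ≤ (N + 1) * τ → (N + 1) * τ ≤ m + 1 → MeetsOpenHalfSpaces fun i => F τ (A i)) ∧
      ∀ τ : ℝ, 0 ≤ τ → (N + 1) * τ ≤ m →
        MeetsOpenHalfSpaces fun i => F τ (Sum.elim c₁ c₂ i τ) := by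
    intro m
    induction m with
    | zero =>
      intro h0
      obtain ⟨A, hAC, hA⟩ := hstep 0 h0
      refine ⟨fun i _ => A i, fun i _ => A i, A, fun _ => continuous_const,
        fun _ => continuous_const, fun i _ => hAC i, fun i _ => hAC i, fun _ _ _ => rfl, hA,
        fun τ h₁ h₂ => ?_⟩
      refine (hA τ (by simpa using by positivity) (by linarith)).of_range_subset ?_
      rintro _ ⟨i, rfl⟩
      exact ⟨Sum.inl i, rfl⟩
    | succ m ih =>
      intro hm
      obtain ⟨c₁, c₂, A, hc₁, hc₂, hC₁, hC₂, hcA, hA, hgood⟩ := ih (by omega)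
      obtain ⟨B, hBC, hB⟩ := hstep (m + 1) hm
      set θ : ℝ → ℝ := fun τ => projIcc 0 1 zero_le_one ((N + 1) * τ - m) with hθ
      have hθc : Continuous θ := by
        simp only [hθ]
        exact continuous_subtype_val.comp (continuous_projIcc.comp (by fun_prop))
      refine ⟨c₂, fun i τ => AffineMap.lineMap (c₁ i τ) (B i) (θ τ), B, hc₂, fun i => ?_, hC₂,
        fun i τ => hC.lineMap_mem (hC₁ i τ) (hBC i) (projIcc 0 1 zero_le_one _).2, ?_, hB, ?_⟩
      · have := hc₁ i
        simp only [AffineMap.lineMap_apply_ring']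
        fun_prop
      · intro τ hτ i
        push_cast at hτ
        have : θ τ = 1 := by
          simp only [hθ]
          rw [projIcc_of_right_le _ (by linarith)]
        simp [this]
      · intro τ h₁ h₂
        push_cast at h₂
        rcases le_total ((N + 1) * τ) m with hle | hle
        · have : θ τ = 0 := by
            simp only [hθ]
            rw [projIcc_of_le_left _ (by linarith)]
          refine (hgood τ h₁ hle).of_range_subset ?_
          rintro _ ⟨i | i, rfl⟩
          · exact ⟨Sum.inr i, by simp [this]⟩
          · exact ⟨Sum.inl i, rfl⟩
        · refine (hA τ hle h₂).of_range_subset ?_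
          rintro _ ⟨i, rfl⟩
          exact ⟨Sum.inl i, by simp [hcA τ hle i]⟩
  obtain ⟨c₁, c₂, -, hc₁, hc₂, hC₁, hC₂, -, -, hgood⟩ := key (N + 1) le_rfl
  refine ⟨Sum.elim c₁ c₂, by simp [hc₁, hc₂], by simp [hC₁, hC₂], fun t ht => hgood t ht.1 ?_⟩
  push_cast
  nlinarith [ht.2]

/-- Sorting a continuous selection and then spreading it slightly makes its values distinct. -/
theorem exists_continuous_injective_selection (hF : Continuous fun q : ℝ × ℝ => F q.1 q.2)
    {a b : ℝ} (hab : a < b) {m : ℕ} {c : Fin m → ℝ → ℝ} (hc : ∀ i, Continuous (c i))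
    (hmem : ∀ i t, c i t ∈ Icc a b)
    (hgood : ∀ t ∈ Icc (0 : ℝ) 1, MeetsOpenHalfSpaces fun i => F t (c i t)) :
    ∃ s : Fin m → ℝ → ℝ, (∀ i, Continuous (s i)) ∧ (∀ i t, s i t ∈ Icc a b) ∧
      (∀ t, Function.Injective fun i => s i t) ∧
      ∀ t ∈ Icc (0 : ℝ) 1, MeetsOpenHalfSpaces fun i => F t (s i t) := by
  set y : Fin m → ℝ → ℝ := fun i t => ((fun j => c j t) ∘ Tuple.sort fun j => c j t) i with hy
  have hyc : ∀ i, Continuous (y i) := fun i =>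
    (continuous_apply i).comp
      ((Tuple.lipschitzWith_comp_sort m).continuous.comp (continuous_pi hc))
  have hymem : ∀ i t, y i t ∈ Icc a b := fun i t => hmem _ t
  have hymono : ∀ t, Monotone fun i => y i t := fun t => Tuple.monotone_sort fun j => c j t
  have hygood : ∀ t ∈ Icc (0 : ℝ) 1, MeetsOpenHalfSpaces fun i => F t (y i t) := by
    intro t ht
    refine (hgood t ht).of_range_subset ?_
    rintro _ ⟨i, rfl⟩
    exact ⟨(Tuple.sort fun j => c j t).symm i, by simp [hy]⟩
  set e : Fin m → ℝ := fun i => AffineMap.lineMap a b ((i : ℝ) / m) with he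
  have hemem : ∀ i, e i ∈ Icc a b := fun i =>
    (convex_Icc a b).lineMap_mem (left_mem_Icc.2 hab.le) (right_mem_Icc.2 hab.le)
      ⟨by positivity, div_le_one_of_le₀ (mod_cast i.2.le) (by positivity)⟩
  have hemono : StrictMono e := by
    intro i j hij
    have hm : (0 : ℝ) < m := mod_cast i.pos
    have hlt : (i : ℝ) / m < j / m := div_lt_div_of_pos_right (mod_cast hij) hm
    simp only [he, AffineMap.lineMap_apply_ring']
    nlinarith
  have hopen : IsOpen {q : ℝ × ℝ |
      MeetsOpenHalfSpaces fun i => F q.2 (AffineMap.lineMap (y i q.2) (e i) q.1)} := by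
    refine isOpen_setOf_meetsOpenHalfSpaces fun i =>
      hF.comp (f := fun q : ℝ × ℝ => (q.2, AffineMap.lineMap (y i q.2) (e i) q.1)) ?_
    have := hyc i
    simp only [AffineMap.lineMap_apply_ring']
    fun_prop
  have hev : ∀ᶠ ε in 𝓝 (0 : ℝ), ∀ t ∈ Icc (0 : ℝ) 1,
      MeetsOpenHalfSpaces fun i => F t (AffineMap.lineMap (y i t) (e i) ε) :=
    isCompact_Icc.eventually_forall_of_forall_eventually fun t ht =>
      hopen.mem_nhds (by simpa using hygood t ht)
  obtain ⟨ε, hεgood, hε0, hε1⟩ : ∃ ε : ℝ, (∀ t ∈ Icc (0 : ℝ) 1,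
      MeetsOpenHalfSpaces fun i => F t (AffineMap.lineMap (y i t) (e i) ε)) ∧ 0 < ε ∧ ε < 1 :=
    ((hev.filter_mono nhdsWithin_le_nhds).and (Ioo_mem_nhdsGT one_pos)).exists
  refine ⟨fun i t => AffineMap.lineMap (y i t) (e i) ε, fun i => ?_, fun i t =>
    (convex_Icc a b).lineMap_mem (hymem i t) (hemem i) ⟨hε0.le, hε1.le⟩, fun t => ?_, hεgood⟩
  · have := hyc i
    simp only [AffineMap.lineMap_apply_ring']
    fun_prop
  · refine StrictMono.injective fun i j hij => ?_
    have h₁ := hymono t hij.le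
    have h₂ := hemono hij
    simp only [AffineMap.lineMap_apply_ring'] at h₁ ⊢
    nlinarith

end Selection

/-- Parametric Steinitz selection: for a continuous family of injective curves, one can
continuously select `4n` distinct parameter values whose images keep `x t` in the
interior of their convex hull. -/
theorem parametric_steinitz {n : ℕ} (hn : 3 ≤ n) (a b : ℝ) (hab : a < b)
    (f : ℝ → ℝ → EuclideanSpace ℝ (Fin n)) (x : ℝ → EuclideanSpace ℝ (Fin n))
    (hf : ContinuousOn (fun q : ℝ × ℝ => f q.1 q.2) (Icc 0 1 ×ˢ Icc a b))
    (hinj : ∀ t ∈ Icc (0 : ℝ) 1, InjOn (f t) (Icc a b))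
    (hx : ContinuousOn x (Icc 0 1))
    (hmem : ∀ t ∈ Icc (0 : ℝ) 1, x t ∈ interior (convexHull ℝ (f t '' Icc a b))) :
    ∃ s : Fin (4 * n) → ℝ → ℝ,
      (∀ i, ContinuousOn (s i) (Icc 0 1)) ∧
      (∀ t ∈ Icc (0 : ℝ) 1, ∀ i, s i t ∈ Icc a b) ∧
      (∀ t ∈ Icc (0 : ℝ) 1, Function.Injective fun i => s i t) ∧
      (∀ t ∈ Icc (0 : ℝ) 1,
        x t ∈ interior (convexHull ℝ (Set.range fun i => f t (s i t)))) := by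
  set F : ℝ → ℝ → EuclideanSpace ℝ (Fin n) := fun t s =>
    f (projIcc 0 1 zero_le_one t) (projIcc a b hab.le s) - x (projIcc 0 1 zero_le_one t) with hFdef
  have hFapply : ∀ t ∈ Icc (0 : ℝ) 1, ∀ s ∈ Icc a b, F t s = f t s - x t := fun t ht s hs => by
    simp only [hFdef, projIcc_of_mem _ ht, projIcc_of_mem _ hs]
  have hproj₁ : Continuous fun t : ℝ => (projIcc 0 1 (zero_le_one' ℝ) t : ℝ) :=
    continuous_subtype_val.comp continuous_projIcc
  have hproj₂ : Continuous fun s : ℝ => (projIcc a b hab.le s : ℝ) :=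
    continuous_subtype_val.comp continuous_projIcc
  have hF : Continuous fun q : ℝ × ℝ => F q.1 q.2 :=
    (hf.comp_continuous ((hproj₁.comp continuous_fst).prodMk (hproj₂.comp continuous_snd))
      fun q => ⟨Subtype.prop _, Subtype.prop _⟩).sub
    (hx.comp_continuous (hproj₁.comp continuous_fst) fun q => Subtype.prop _)
  obtain ⟨c, hc, hcmem, hcgood⟩ := exists_continuous_sum_selection hF (ι := Fin (2 * n))
    (convex_Icc a b) fun t ht => by
      have h0 : (0 : EuclideanSpace ℝ (Fin n)) ∈
          interior (convexHull ℝ (-x t +ᵥ f t '' Icc a b)) := by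
        rw [convexHull_vadd, interior_vadd]
        exact ⟨x t, hmem t ht, by simp⟩
      have hp := exists_fin_meetsOpenHalfSpaces h0
      rw [finrank_euclideanSpace_fin] at hp
      obtain ⟨p, hp, hpgood⟩ := hp
      have : ∀ i, ∃ s ∈ Icc a b, f t s - x t = p i := fun i => by
        obtain ⟨_, ⟨s, hs, rfl⟩, hsp⟩ := hp (mem_range_self i)
        exact ⟨s, hs, (sub_eq_neg_add _ _).trans hsp⟩
      choose A hA hAp using this
      refine ⟨A, hA, ?_⟩
      simpa only [hFapply t ht _ (hA _), hAp] using hpgood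
  let e : Fin (4 * n) ≃ Fin (2 * n) ⊕ Fin (2 * n) :=
    (finCongr (by omega)).trans finSumFinEquiv.symm
  obtain ⟨s, hs, hsmem, hsinj, hsgood⟩ := exists_continuous_injective_selection hF hab
    (c := c ∘ e) (fun i => hc _) (fun i => hcmem _) fun t ht =>
      (hcgood t ht).of_range_subset (by
        rintro _ ⟨i, rfl⟩
        exact ⟨e.symm i, by simp⟩)
  refine ⟨s, fun i => (hs i).continuousOn, fun t _ i => hsmem i t, fun t _ => hsinj t,
    fun t ht => ?_⟩
  have : Nonempty (Fin (4 * n)) := ⟨⟨0, by omega⟩⟩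
  refine MeetsOpenHalfSpaces.mem_interior_convexHull_range ?_
  simpa only [hFapply t ht _ (hsmem _ t)] using hsgood t ht
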